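/- arXiv:1405.0985 — 2 statements merged into one kernel-verified Lean document; each statement's English description precedes it below -/
import Mathlib

section
/- Let H be a complex Hilbert space with an orthogonal decomposition H = H_L ⊕ H_C ⊕ H_R, and let U = A ∘ B be an H_C-overlapping factorization of a unitary operator U on H. Let V_L ⊆ H_L and V_R ⊆ H_R be closed subspaces, and set V = V_L ⊕ H_C ⊕ V_R, V_LC = V_L ⊕ H_C, V_CR = H_C ⊕ V_R, with orthogonal projections P (onto V), Q_L, Q_R, Q_LC, Q_CR (onto V_L, V_R, V_LC, V_CR). Then for every z ∈ ℂ with |z| < 1 the operators U − z·(1 − P), A − z·(P_LC − Q_LC) and B − z·(P_CR − Q_CR) are invertible in B(H), and P ∘ (U − z·(1 − P))^{-1} ∘ P = (Q_L + Q_CR∘(B − z·(P_CR − Q_CR))^{-1}∘Q_CR) ∘ (Q_LC∘(A − z·(P_LC − Q_LC))^{-1}∘Q_LC + Q_R). (This is Khrushchev's formula f_V = (1_{V_L} ⊕ f^R_{V_CR}) (f^L_{V_LC} ⊕ 1_{V_R}) for the U-Schur function of V in terms of the U_LC-Schur function of V_LC and the U_CR-Schur function of V_CR.) -/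
/-- An `H_C`-overlapping factorization of a unitary `U` relative to the orthogonal
decomposition `H = H_L ⊕ H_C ⊕ H_R` (encoded by the orthogonal projections
`PL, PC, PR`): unitaries `A, B` with `U = A ∘ B`, `A` fixing `H_R` pointwise and mapping
`H_LC = H_L ⊕ H_C` into itself, and `B` fixing `H_L` pointwise and mapping
`H_CR = H_C ⊕ H_R` into itself.  (`A` corresponds to `U_LC ⊕ 1`, `B` to `1 ⊕ U_CR`.) -/
def IsOverlapFac {H : Type*} [NormedAddCommGroup H] [InnerProductSpace ℂ H]
    [CompleteSpace H] (PL PC PR U A B : H →L[ℂ] H) : Prop :=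
  A ∈ unitary (H →L[ℂ] H) ∧ B ∈ unitary (H →L[ℂ] H) ∧ U = A * B ∧
  A * PR = PR ∧ (PL + PC) * (A * (PL + PC)) = A * (PL + PC) ∧
  B * PL = PL ∧ (PC + PR) * (B * (PC + PR)) = B * (PC + PR)

theorem aux_isUnit {H : Type*} [NormedAddCommGroup H] [InnerProductSpace ℂ H]
    [CompleteSpace H] (W M : H →L[ℂ] H) (hW : W ∈ unitary (H →L[ℂ] H))
    (hsa : IsSelfAdjoint M) (hi : M * M = M) (z : ℂ) (hz : ‖z‖ < 1) :
    IsUnit (W - z • M) := by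
  have hM : ‖M‖ ≤ 1 := by
    have h := CStarRing.norm_star_mul_self (x := M)
    rw [hsa.star_eq, hi] at h
    by_contra hc
    push Not at hc
    nlinarith
  have hW1 : W * star W = 1 := (Unitary.mem_iff.1 hW).2
  have hW2 : star W * W = 1 := (Unitary.mem_iff.1 hW).1
  have hn : ‖star W * M‖ ≤ 1 := by
    have h := CStarRing.norm_star_mul_self (x := star W * M)
    have e : star (star W * M) * (star W * M) = M := by
      rw [star_mul, star_star, hsa.star_eq, mul_assoc, ← mul_assoc W, hW1, one_mul, hi]
    rw [e] at h
    by_contra hc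
    push Not at hc
    nlinarith
  have hlt : ‖z • (star W * M)‖ < 1 := by
    rw [norm_smul]
    nlinarith [norm_nonneg z, norm_nonneg (star W * M)]
  have hu : IsUnit (1 - z • (star W * M)) := isUnit_one_sub_of_norm_lt_one hlt
  have hWu : IsUnit W := ⟨⟨W, star W, hW1, hW2⟩, rfl⟩
  have e : W - z • M = W * (1 - z • (star W * M)) := by
    rw [mul_sub, mul_one, mul_smul_comm, ← mul_assoc, hW1, one_mul]
  rw [e]
  exact hWu.mul hu

/-- if `W` is unitary and fixes the range of a self-adjoint `Q`, so does its adjoint. -/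
theorem aux_left {H : Type*} [NormedAddCommGroup H] [InnerProductSpace ℂ H]
    [CompleteSpace H] (W Q : H →L[ℂ] H) (hW : W ∈ unitary (H →L[ℂ] H))
    (hsa : IsSelfAdjoint Q) (h : W * Q = Q) : Q * W = Q := by
  have hW2 : star W * W = 1 := (Unitary.mem_iff.1 hW).1
  have h1 : star W * Q = Q := by
    nth_rewrite 1 [← h]
    rw [← mul_assoc, hW2, one_mul]
  have h2 := congrArg star h1
  rwa [star_mul, star_star, hsa.star_eq] at h2

theorem aux_swap {H : Type*} [NormedAddCommGroup H] [InnerProductSpace ℂ H]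
    [CompleteSpace H] {S T R : H →L[ℂ] H} (hS : IsSelfAdjoint S) (hT : IsSelfAdjoint T)
    (hR : IsSelfAdjoint R) (h : S * T = R) : T * S = R := by
  have h2 := congrArg star h
  rwa [star_mul, hS.star_eq, hT.star_eq, hR.star_eq] at h2

/-- (Khrushchev's formula for overlapping factorizations of unitaries.)
Let `U = A ∘ B` be an `H_C`-overlapping factorization, and let `V_L ⊆ H_L`, `V_R ⊆ H_R`
be closed subspaces with orthogonal projections `QL, QR`.  With `P = QL + PC + QR`
(projection onto `V = V_L ⊕ H_C ⊕ V_R`), `Q_LC = QL + PC`, `Q_CR = PC + QR`, for `|z| < 1`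
the relevant operators are invertible and the `U`-Schur function of `V` factorizes:
`P (U − z(1−P))⁻¹ P = (QL + Q_CR (B − z(P_CR − Q_CR))⁻¹ Q_CR) ∘
(Q_LC (A − z(P_LC − Q_LC))⁻¹ Q_LC + QR)`. -/
theorem statement11 {H : Type*} [NormedAddCommGroup H] [InnerProductSpace ℂ H]
    [CompleteSpace H] (PL PC PR : H →L[ℂ] H)
    (hPLsa : IsSelfAdjoint PL) (hPLi : PL * PL = PL)
    (hPCsa : IsSelfAdjoint PC) (hPCi : PC * PC = PC)
    (hPRsa : IsSelfAdjoint PR) (hPRi : PR * PR = PR)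
    (hsum : PL + PC + PR = 1)
    (hLC : PL * PC = 0) (hLR : PL * PR = 0) (hCR : PC * PR = 0)
    (U A B : H →L[ℂ] H) (hU : U ∈ unitary (H →L[ℂ] H))
    (hfac : IsOverlapFac PL PC PR U A B)
    (QL QR : H →L[ℂ] H)
    (hQLsa : IsSelfAdjoint QL) (hQLi : QL * QL = QL) (hQLsub : PL * QL = QL)
    (hQRsa : IsSelfAdjoint QR) (hQRi : QR * QR = QR) (hQRsub : PR * QR = QR)
    (z : ℂ) (hz : ‖z‖ < 1) :
    IsUnit (U - z • ((1 : H →L[ℂ] H) - (QL + PC + QR))) ∧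
    IsUnit (A - z • ((PL + PC) - (QL + PC))) ∧
    IsUnit (B - z • ((PC + PR) - (PC + QR))) ∧
    (QL + PC + QR) * Ring.inverse (U - z • ((1 : H →L[ℂ] H) - (QL + PC + QR))) *
        (QL + PC + QR) =
      (QL + (PC + QR) * Ring.inverse (B - z • ((PC + PR) - (PC + QR))) * (PC + QR)) *
        ((QL + PC) * Ring.inverse (A - z • ((PL + PC) - (QL + PC))) * (QL + PC) + QR) := by
  obtain ⟨hA, hB, hUAB, hAR, -, hBL, -⟩ := hfac
  have hRA := aux_left A PR hA hPRsa hAR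
  have hLB := aux_left B PL hB hPLsa hBL
  have z0 : IsSelfAdjoint (0 : H →L[ℂ] H) := IsSelfAdjoint.zero _
  have hRL := aux_swap hPLsa hPRsa z0 hLR
  have hCL := aux_swap hPLsa hPCsa z0 hLC
  have hRC := aux_swap hPCsa hPRsa z0 hCR
  have hQLP := aux_swap hPLsa hQLsa hQLsa hQLsub
  have hQRP := aux_swap hPRsa hQRsa hQRsa hQRsub
  -- products with QL, QR
  have qLC : QL * PC = 0 := by rw [← hQLP, mul_assoc, hLC, mul_zero]
  have qCL : PC * QL = 0 := by rw [← hQLsub, ← mul_assoc, hCL, zero_mul]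
  have qLR : QL * PR = 0 := by rw [← hQLP, mul_assoc, hLR, mul_zero]
  have qRL : PR * QL = 0 := by rw [← hQLsub, ← mul_assoc, hRL, zero_mul]
  have rRC : QR * PC = 0 := by rw [← hQRP, mul_assoc, hRC, mul_zero]
  have rCR : PC * QR = 0 := by rw [← hQRsub, ← mul_assoc, hCR, zero_mul]
  have rRL : QR * PL = 0 := by rw [← hQRP, mul_assoc, hRL, mul_zero]
  have rLR : PL * QR = 0 := by rw [← hQRsub, ← mul_assoc, hLR, zero_mul]
  have qr : QL * QR = 0 := by rw [← hQRsub, ← mul_assoc, qLR, zero_mul]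
  have rq : QR * QL = 0 := by rw [← hQLsub, ← mul_assoc, rRL, zero_mul]
  have eM : (PL + PC) - (QL + PC) = PL - QL := by abel
  have eN : (PC + PR) - (PC + QR) = PR - QR := by abel
  have eMN : (1 : H →L[ℂ] H) - (QL + PC + QR) = (PL - QL) + (PR - QR) := by
    rw [← hsum]; abel
  rw [eM, eN, eMN]
  have ua : IsUnit (A - z • (PL - QL)) := by
    refine aux_isUnit A _ hA (hPLsa.sub hQLsa) ?_ z hz
    rw [mul_sub, sub_mul, sub_mul, hPLi, hQLP, hQLsub, hQLi]; abel
  have ub : IsUnit (B - z • (PR - QR)) := by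
    refine aux_isUnit B _ hB (hPRsa.sub hQRsa) ?_ z hz
    rw [mul_sub, sub_mul, sub_mul, hPRi, hQRP, hQRsub, hQRi]; abel
  have hAN : A * (PR - QR) = PR - QR := by
    rw [mul_sub, hAR, ← hQRsub, ← mul_assoc, hAR]
  have hMB : (PL - QL) * B = PL - QL := by
    rw [sub_mul, hLB, ← hQLP, mul_assoc, hLB]
  have hMN : (PL - QL) * (PR - QR) = 0 := by
    rw [mul_sub, sub_mul, sub_mul, hLR, qLR, rLR, qr]; simp
  have hab : U - z • ((PL - QL) + (PR - QR)) = (A - z • (PL - QL)) * (B - z • (PR - QR)) := by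
    rw [sub_mul, mul_sub, mul_sub, mul_smul_comm, hAN, smul_mul_assoc, hMB, smul_mul_assoc,
      mul_smul_comm, hMN, hUAB, smul_add]
    simp only [smul_zero]
    abel
  have aR : PR * (A - z • (PL - QL)) = PR := by
    rw [mul_sub, hRA, mul_smul_comm, mul_sub, hRL, qRL]; simp
  have Ra : (A - z • (PL - QL)) * PR = PR := by
    rw [sub_mul, hAR, smul_mul_assoc, sub_mul, hLR, qLR]; simp
  have bL : PL * (B - z • (PR - QR)) = PL := by
    rw [mul_sub, hLB, mul_smul_comm, mul_sub, hLR, rLR]; simp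
  have Lb : (B - z • (PR - QR)) * PL = PL := by
    rw [sub_mul, hBL, smul_mul_assoc, sub_mul, hRL, rRL]; simp
  rw [hab]
  refine ⟨ua.mul ub, ua, ub, ?_⟩
  generalize A - z • (PL - QL) = a at *
  generalize B - z • (PR - QR) = b at *
  obtain ⟨a, rfl⟩ := ua
  obtain ⟨b, rfl⟩ := ub
  rw [← Units.val_mul, Ring.inverse_unit, Ring.inverse_unit, Ring.inverse_unit, mul_inv_rev,
    Units.val_mul]
  have aR' : PR * (↑a⁻¹ : H →L[ℂ] H) = PR := by rw [Units.mul_inv_eq_iff_eq_mul, aR]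
  have Ra' : (↑a⁻¹ : H →L[ℂ] H) * PR = PR := by rw [Units.inv_mul_eq_iff_eq_mul, Ra]
  have bL' : PL * (↑b⁻¹ : H →L[ℂ] H) = PL := by rw [Units.mul_inv_eq_iff_eq_mul, bL]
  have Lb' : (↑b⁻¹ : H →L[ℂ] H) * PL = PL := by rw [Units.inv_mul_eq_iff_eq_mul, Lb]
  generalize (↑a⁻¹ : H →L[ℂ] H) = a' at *
  generalize (↑b⁻¹ : H →L[ℂ] H) = b' at *
  have qRa : QR * a' = QR := by rw [← hQRP, mul_assoc, aR']
  have qaR : a' * QR = QR := by rw [← hQRsub, ← mul_assoc, Ra']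
  have qLb : QL * b' = QL := by rw [← hQLP, mul_assoc, bL']
  have qbL : b' * QL = QL := by rw [← hQLsub, ← mul_assoc, Lb']
  have e1 : QL + (PC + QR) * b' * (PC + QR) = (QL + PC + QR) * b' * (QL + PC + QR) := by
    simp only [add_mul, mul_add, mul_assoc, qLb, qbL, hQLi, qLC, qCL, qr, rq]
    simp only [← mul_assoc, qLb, hQLi, qLC, qr]
    abel
  have e2 : (QL + PC) * a' * (QL + PC) + QR = (QL + PC + QR) * a' * (QL + PC + QR) := by
    simp only [add_mul, mul_add, mul_assoc, qaR, hQRi, rRC, rCR, qr, rq]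
    simp only [← mul_assoc, qRa, hQRi, rRC, rq]
    abel
  have PM : (QL + PC + QR) * (PL - QL) = 0 := by
    simp only [add_mul, mul_sub, hQLP, hQLi, hCL, qCL, rRL, rq]; abel
  have NP : (PR - QR) * (QL + PC + QR) = 0 := by
    simp only [mul_add, sub_mul, qRL, hRC, hQRsub, rq, rRC, hQRi]; abel
  have PP : (QL + PC + QR) * (QL + PC + QR) = QL + PC + QR := by
    simp only [mul_add, add_mul, hQLi, qCL, rq, qLC, hPCi, rRC, qr, rCR, hQRi]; abel
  have bM : b' * (PL - QL) = PL - QL := by rw [mul_sub, Lb', qbL]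
  have Na : (PR - QR) * a' = PR - QR := by rw [sub_mul, aR', qRa]
  rw [e1, e2]
  have e1' : (1 : H →L[ℂ] H) = (QL + PC + QR) + (PL - QL) + (PR - QR) := by
    rw [← hsum]; abel
  generalize QL + PC + QR = P at *
  generalize PL - QL = M at *
  generalize PR - QR = N at *
  calc P * (b' * a') * P = P * b' * 1 * a' * P := by simp only [mul_one, mul_assoc]
    _ = P * b' * P * a' * P + P * (b' * M) * a' * P + P * b' * ((N * a') * P) := by
      rw [e1']; simp only [mul_add, add_mul, mul_assoc]
    _ = P * b' * P * a' * P := by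
      rw [bM, PM, Na, NP]; simp
    _ = P * b' * (P * P) * a' * P := by rw [PP]
    _ = P * b' * P * (P * a' * P) := by simp only [mul_assoc]
end

section
/- Fix integers d ≥ 1 and N ≥ 1 and d×d complex matrices α_0, …, α_{N−1} with ‖α_j‖ ≤ 1, and form the finite block CMV matrices C_N = C_N(α_0,…,α_{N−1}) and Ĉ_N = Ĉ_N(α_0,…,α_{N−1}), which are unitary matrices of size (N+1)d. For 0 ≤ j ≤ N let P_j be the orthogonal projection of ℂ^{(N+1)d} onto V_j, the span of the canonical basis vectors with indices jd, jd+1, …, jd+d−1. For a unitary matrix X of size (N+1)d and |z| < 1, the matrix X − z(1 − P_j) is invertible; write S_j(X, z) = P_j (X − z(1 − P_j))^{-1} P_j (the X-Schur function of V_j). Set D_j = C_j(α_0,…,α_{j−1}) ⊕ 1_{(N−j)d}, D̂_j = Ĉ_j(α_0,…,α_{j−1}) ⊕ 1_{(N−j)d}, E_j = 1_{jd} ⊕ C_{N−j}(α_j,…,α_{N−1}), Ê_j = 1_{jd} ⊕ Ĉ_{N−j}(α_j,…,α_{N−1}). Then for every 0 < j < N and every |z| < 1 (Khrushchev's formula for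 block CMV matrices): if j is even, S_j(C_N, z) = S_j(D_j, z)·S_j(E_j, z) and S_j(Ĉ_N, z) = S_j(Ê_j, z)·S_j(D̂_j, z); if j is odd, S_j(C_N, z) = S_j(Ê_j, z)·S_j(D_j, z) and S_j(Ĉ_N, z) = S_j(D̂_j, z)·S_j(E_j, z). -/
open Matrix
open scoped ComplexOrder

/-- The elementary CMV block `Θ_j^{(N)} = 1_{jd} ⊕ Θ(α_j) ⊕ 1_{(N−j−1)d}` of size
`(N+1)d`, indexed by `Fin (N+1) × Fin d` (block index first), where
`Θ(α) = [[αᴴ, ρ^L], [ρ^R, −α]]`. -/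
noncomputable def thetaBlock (d N j : ℕ) (A ρl ρr : Matrix (Fin d) (Fin d) ℂ) :
    Matrix (Fin (N + 1) × Fin d) (Fin (N + 1) × Fin d) ℂ := fun p q =>
  if p.1.val = j ∧ q.1.val = j then Aᴴ p.2 q.2
  else if p.1.val = j ∧ q.1.val = j + 1 then ρl p.2 q.2
  else if p.1.val = j + 1 ∧ q.1.val = j then ρr p.2 q.2
  else if p.1.val = j + 1 ∧ q.1.val = j + 1 then (-A) p.2 q.2
  else if p = q then 1 else 0

/-- `L_N`: the product of the blocks `Θ_j^{(N)}` over even `j < N` (the factors pairwise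
commute, so the ascending order chosen here is irrelevant). -/
noncomputable def cmvLfactor (d N : ℕ) (α ρl ρr : ℕ → Matrix (Fin d) (Fin d) ℂ) :
    Matrix (Fin (N + 1) × Fin d) (Fin (N + 1) × Fin d) ℂ :=
  ((List.range N).map fun j =>
    if Even j then thetaBlock d N j (α j) (ρl j) (ρr j) else 1).prod

/-- `M_N`: the product of the blocks `Θ_j^{(N)}` over odd `j < N`. -/
noncomputable def cmvMfactor (d N : ℕ) (α ρl ρr : ℕ → Matrix (Fin d) (Fin d) ℂ) :
    Matrix (Fin (N + 1) × Fin d) (Fin (N + 1) × Fin d) ℂ :=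
  ((List.range N).map fun j =>
    if Odd j then thetaBlock d N j (α j) (ρl j) (ρr j) else 1).prod

/-- The finite block CMV matrix `C_N(α_0, …, α_{N−1}) = L_N · M_N`. -/
noncomputable def cmvC (d N : ℕ) (α ρl ρr : ℕ → Matrix (Fin d) (Fin d) ℂ) :
    Matrix (Fin (N + 1) × Fin d) (Fin (N + 1) × Fin d) ℂ :=
  cmvLfactor d N α ρl ρr * cmvMfactor d N α ρl ρr

/-- The alternate finite block CMV matrix `Ĉ_N(α_0, …, α_{N−1}) = M_N · L_N`. -/
noncomputable def cmvChat (d N : ℕ) (α ρl ρr : ℕ → Matrix (Fin d) (Fin d) ℂ) :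
    Matrix (Fin (N + 1) × Fin d) (Fin (N + 1) × Fin d) ℂ :=
  cmvMfactor d N α ρl ρr * cmvLfactor d N α ρl ρr

/-- Embed a matrix of `m+1` blocks into one of `N+1` blocks at block offset `o`, acting
as the identity outside: this realizes the block-diagonal direct sums `1_{od} ⊕ M ⊕ 1_…`. -/
noncomputable def embedAt (d N o m : ℕ)
    (M : Matrix (Fin (m + 1) × Fin d) (Fin (m + 1) × Fin d) ℂ) :
    Matrix (Fin (N + 1) × Fin d) (Fin (N + 1) × Fin d) ℂ := fun p q =>
  if h : o ≤ p.1.val ∧ p.1.val ≤ o + m ∧ o ≤ q.1.val ∧ q.1.val ≤ o + m then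
    M (⟨p.1.val - o, by omega⟩, p.2) (⟨q.1.val - o, by omega⟩, q.2)
  else if p = q then 1 else 0

/-- The orthogonal projection of `ℂ^{(N+1)d}` onto the canonical subspace `V_j`, spanned
by the canonical basis vectors in the `j`-th block. -/
noncomputable def blockProj (d N j : ℕ) :
    Matrix (Fin (N + 1) × Fin d) (Fin (N + 1) × Fin d) ℂ := fun p q =>
  if p = q ∧ p.1.val = j then 1 else 0

/-- The `X`-Schur function of the canonical subspace `V_j`:
`S_j(X, z) = P_j (X − z(1 − P_j))⁻¹ P_j`. -/
noncomputable def schurFn (d N : ℕ)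
    (X : Matrix (Fin (N + 1) × Fin d) (Fin (N + 1) × Fin d) ℂ) (j : ℕ) (z : ℂ) :
    Matrix (Fin (N + 1) × Fin d) (Fin (N + 1) × Fin d) ℂ :=
  blockProj d N j * (X - z • (1 - blockProj d N j))⁻¹ * blockProj d N j

section Helpers

theorem khr_abstract {n : Type*} [Fintype n] [DecidableEq n] (D E P Q1 Q2 : Matrix n n ℂ) (z : ℂ)
    (hs : P + Q1 + Q2 = 1) (h12 : Q1 * Q2 = 0) (h21 : Q2 * Q1 = 0)
    (hp2 : P * Q2 = 0) (h1p : Q1 * P = 0)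
    (hD2 : D * Q2 = Q2) (h2D : Q2 * D = Q2) (hE1 : E * Q1 = Q1) (h1E : Q1 * E = Q1)
    (uD : IsUnit (D - z • (1 - P))) (uE : IsUnit (E - z • (1 - P))) :
    P * (E * D - z • (1 - P))⁻¹ * P =
      (P * (D - z • (1 - P))⁻¹ * P) * (P * (E - z • (1 - P))⁻¹ * P) := by
  have hq : (1 : Matrix n n ℂ) - P = Q1 + Q2 := by rw [← hs]; abel
  have eD : D - z • (1 - P) = (D - z • Q1) * (1 - z • Q2) := by
    simp only [hq, sub_mul, mul_sub, smul_mul_assoc, mul_smul_comm, h12, hD2, mul_one, smul_add,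
      smul_zero]
    abel
  have eE : E - z • (1 - P) = (1 - z • Q1) * (E - z • Q2) := by
    simp only [hq, sub_mul, mul_sub, smul_mul_assoc, mul_smul_comm, h12, h1E, one_mul, smul_add,
      smul_zero]
    abel
  have eED : E * D - z • (1 - P) = (E - z • Q2) * (D - z • Q1) := by
    simp only [hq, sub_mul, mul_sub, smul_mul_assoc, mul_smul_comm, h21, hE1, h2D, smul_add,
      smul_zero]
    abel
  rw [eD, Matrix.isUnit_iff_isUnit_det, det_mul] at uD
  rw [eE, Matrix.isUnit_iff_isUnit_det, det_mul] at uE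
  have u1 := isUnit_of_mul_isUnit_left uD
  have u2 := isUnit_of_mul_isUnit_right uD
  have u3 := isUnit_of_mul_isUnit_left uE
  have u4 := isUnit_of_mul_isUnit_right uE
  rw [eD, eE, eED, Matrix.mul_inv_rev, Matrix.mul_inv_rev, Matrix.mul_inv_rev]
  have a1 : P * (1 - z • Q2)⁻¹ = P := by
    have : P * (1 - z • Q2) = P := by simp [mul_sub, hp2]
    calc P * (1 - z • Q2)⁻¹ = P * (1 - z • Q2) * (1 - z • Q2)⁻¹ := by rw [this]
      _ = P := by rw [mul_assoc, Matrix.mul_nonsing_inv _ u2, mul_one]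
  have a2 : (1 - z • Q1)⁻¹ * P = P := by
    have : (1 - z • Q1) * P = P := by simp [sub_mul, h1p]
    calc (1 - z • Q1)⁻¹ * P = (1 - z • Q1)⁻¹ * ((1 - z • Q1) * P) := by rw [this]
      _ = P := by rw [← mul_assoc, Matrix.nonsing_inv_mul _ u3, one_mul]
  have a3 : (D - z • Q1)⁻¹ * Q2 = Q2 := by
    have : (D - z • Q1) * Q2 = Q2 := by simp [sub_mul, h12, hD2]
    calc (D - z • Q1)⁻¹ * Q2 = (D - z • Q1)⁻¹ * ((D - z • Q1) * Q2) := by rw [this]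
      _ = Q2 := by rw [← mul_assoc, Matrix.nonsing_inv_mul _ u1, one_mul]
  have a4 : Q1 * (E - z • Q2)⁻¹ = Q1 := by
    have : Q1 * (E - z • Q2) = Q1 := by simp [mul_sub, h12, h1E]
    calc Q1 * (E - z • Q2)⁻¹ = Q1 * (E - z • Q2) * (E - z • Q2)⁻¹ := by rw [this]
      _ = Q1 := by rw [mul_assoc, Matrix.mul_nonsing_inv _ u4, mul_one]
  have hPP : P * P = P := by
    have : P * (P + Q1 + Q2) * P = P * P := by rw [hs, mul_one]
    have h' : (P + Q1 + Q2) * P = P := by rw [hs, one_mul]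
    have h3 : P * (P + Q1 + Q2) = P := by rw [hs, mul_one]
    have h4 : Q2 * P = 0 := by
      have k : Q2 * (P + Q1 + Q2) = Q2 := by rw [hs, mul_one]
      have k2 : (P + Q1 + Q2) * Q2 = Q2 := by rw [hs, one_mul]
      rw [mul_add, mul_add, h21, add_zero] at k
      rw [add_mul, add_mul, hp2, h12, zero_add, zero_add] at k2
      rw [k2] at k
      exact add_eq_right.mp k
    rw [add_mul, add_mul, h1p, h4, add_zero, add_zero] at h'
    exact h'
  generalize (D - z • Q1)⁻¹ = X at *
  generalize (E - z • Q2)⁻¹ = Y at *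
  rw [← mul_assoc P _ X, a1, mul_assoc P (Y * _), mul_assoc Y, a2]
  calc P * (X * Y) * P = P * X * (P + Q1 + Q2) * Y * P := by rw [hs]; simp only [mul_one, mul_assoc]
    _ = P * X * P * Y * P + P * X * (Q1 * Y * P) + P * (X * Q2) * Y * P := by noncomm_ring
    _ = P * X * P * Y * P := by rw [a4, h1p, a3, hp2]; simp
    _ = P * X * P * (P * (Y * P)) := by
      rw [← mul_assoc (P * X * P) P, mul_assoc (P * X) P P, hPP]; simp only [mul_assoc]

open scoped Matrix.Norms.L2Operator in
theorem isUnit_unitary_sub {n : Type*} [Fintype n] [DecidableEq n] (X : Matrix n n ℂ)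
    (hX : X ∈ Matrix.unitaryGroup n ℂ) (v : n → ℂ) (hv : ‖v‖ ≤ 1) (w : ℂ) (hw : ‖w‖ < 1) :
    IsUnit (X - w • diagonal v) := by
  have h1 : X - w • diagonal v = X * (1 - star X * (w • diagonal v)) := by
    rw [mul_sub, mul_one, ← mul_assoc, Unitary.mul_star_self_of_mem hX, one_mul]
  rw [h1]
  refine IsUnit.mul ?_ (isUnit_one_sub_of_norm_lt_one ?_)
  · exact ⟨Unitary.toUnits ⟨X, hX⟩, rfl⟩
  · have : ‖star X * (w • diagonal v)‖ = ‖w • diagonal v‖ :=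
      CStarRing.norm_coe_unitary_mul ⟨star X, Unitary.star_mem hX⟩ _
    rw [this, norm_smul, l2_opNorm_diagonal]
    calc ‖w‖ * ‖v‖ ≤ ‖w‖ * 1 := by gcongr
      _ < 1 := by simpa using hw

open Classical in
/-- Coordinate projection onto the blocks in `s`. -/
noncomputable def blkQ (d N : ℕ) (s : ℕ → Prop) :
    Matrix (Fin (N + 1) × Fin d) (Fin (N + 1) × Fin d) ℂ :=
  diagonal fun p => if s p.1.val then 1 else 0

theorem blockProj_eq (d N j : ℕ) : blockProj d N j = blkQ d N (· = j) := by
  ext p q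
  simp only [blockProj, blkQ, diagonal_apply]
  by_cases h : p = q <;> simp [h]

theorem blkQ_mul_disj (d N : ℕ) (s t : ℕ → Prop) (h : ∀ i, s i → ¬ t i) :
    blkQ d N s * blkQ d N t = 0 := by
  rw [blkQ, blkQ, diagonal_mul_diagonal, ← diagonal_zero]
  congr 1
  ext p
  by_cases h1 : s p.1.val
  · simp [h _ h1]
  · simp [h1]

/-- `X` is the identity outside the blocks in `s`. -/
def IdOff (d N : ℕ) (s : ℕ → Prop)
    (X : Matrix (Fin (N + 1) × Fin d) (Fin (N + 1) × Fin d) ℂ) : Prop :=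
  (X - 1) * blkQ d N s = X - 1 ∧ blkQ d N s * (X - 1) = X - 1

theorem IdOff.one (d N : ℕ) (s : ℕ → Prop) : IdOff d N s 1 := by simp [IdOff]

theorem IdOff.mul {d N : ℕ} {s : ℕ → Prop}
    {X Y : Matrix (Fin (N + 1) × Fin d) (Fin (N + 1) × Fin d) ℂ}
    (hX : IdOff d N s X) (hY : IdOff d N s Y) : IdOff d N s (X * Y) := by
  have e : X * Y - 1 = (X - 1) * (Y - 1) + (X - 1) + (Y - 1) := by noncomm_ring
  unfold IdOff
  rw [e]
  constructor
  · rw [add_mul, add_mul, mul_assoc, hX.1, hY.1]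
  · rw [mul_add, mul_add, ← mul_assoc, hX.2, hY.2]

theorem IdOff.commute {d N : ℕ} {s t : ℕ → Prop}
    {X Y : Matrix (Fin (N + 1) × Fin d) (Fin (N + 1) × Fin d) ℂ}
    (hX : IdOff d N s X) (hY : IdOff d N t Y) (h : ∀ i, s i → ¬ t i) : X * Y = Y * X := by
  have h1 : (X - 1) * (Y - 1) = 0 := by
    rw [← hX.1, ← hY.2, mul_assoc, ← mul_assoc (blkQ d N s), blkQ_mul_disj d N s t h]; simp
  have h2 : (Y - 1) * (X - 1) = 0 := by
    rw [← hX.2, ← hY.1, mul_assoc, ← mul_assoc (blkQ d N t),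
      blkQ_mul_disj d N t s (fun i a b => h i b a)]; simp
  have e : X * Y - Y * X = (X - 1) * (Y - 1) - (Y - 1) * (X - 1) := by noncomm_ring
  rw [h1, h2, sub_zero] at e
  exact sub_eq_zero.mp e

theorem IdOff.mul_blkQ {d N : ℕ} {s t : ℕ → Prop}
    {X : Matrix (Fin (N + 1) × Fin d) (Fin (N + 1) × Fin d) ℂ}
    (hX : IdOff d N s X) (h : ∀ i, s i → ¬ t i) :
    X * blkQ d N t = blkQ d N t ∧ blkQ d N t * X = blkQ d N t := by
  constructor
  · have : (X - 1) * blkQ d N t = 0 := by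
      rw [← hX.1, mul_assoc, blkQ_mul_disj d N s t h, mul_zero]
    rw [sub_mul, one_mul] at this
    exact sub_eq_zero.mp this
  · have : blkQ d N t * (X - 1) = 0 := by
      rw [← hX.2, ← mul_assoc, blkQ_mul_disj d N t s (fun i a b => h i b a), zero_mul]
    rw [mul_sub, mul_one] at this
    exact sub_eq_zero.mp this

theorem thetaBlock_idOff (d N k : ℕ) (A B C : Matrix (Fin d) (Fin d) ℂ) (s : ℕ → Prop)
    (h0 : s k) (h1 : s (k + 1)) : IdOff d N s (thetaBlock d N k A B C) := by
  constructor
  · ext p q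
    rw [blkQ, mul_diagonal]
    by_cases hq : s q.1.val
    · simp [hq]
    · have n0 : q.1.val ≠ k := fun h => hq (h ▸ h0)
      have n1 : q.1.val ≠ k + 1 := fun h => hq (h ▸ h1)
      simp [thetaBlock, n0, n1, hq, Matrix.one_apply]
  · ext p q
    rw [blkQ, diagonal_mul]
    by_cases hq : s p.1.val
    · simp [hq]
    · have n0 : p.1.val ≠ k := fun h => hq (h ▸ h0)
      have n1 : p.1.val ≠ k + 1 := fun h => hq (h ▸ h1)
      simp [thetaBlock, n0, n1, hq, Matrix.one_apply]

theorem isUnit_schur (d N j : ℕ) (X : Matrix (Fin (N + 1) × Fin d) (Fin (N + 1) × Fin d) ℂ)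
    (hX : X ∈ Matrix.unitaryGroup (Fin (N + 1) × Fin d) ℂ) (w : ℂ) (hw : ‖w‖ < 1) :
    IsUnit (X - w • (1 - blockProj d N j)) := by
  have : (1 : Matrix (Fin (N + 1) × Fin d) (Fin (N + 1) × Fin d) ℂ) - blockProj d N j
      = diagonal fun p => if p.1.val = j then 0 else 1 := by
    ext p q
    simp only [blockProj, Matrix.sub_apply, one_apply, diagonal_apply]
    by_cases h : p = q <;> by_cases h' : q.1.val = j <;> simp [h, h']
  rw [this]
  refine isUnit_unitary_sub X hX _ ?_ w hw
  rw [pi_norm_le_iff_of_nonneg zero_le_one]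
  intro p
  split_ifs <;> simp

theorem schur_lem (d N j : ℕ) (D E : Matrix (Fin (N + 1) × Fin d) (Fin (N + 1) × Fin d) ℂ)
    (hD : IdOff d N (· ≤ j) D) (hE : IdOff d N (j ≤ ·) E)
    (uD : D ∈ Matrix.unitaryGroup (Fin (N + 1) × Fin d) ℂ)
    (uE : E ∈ Matrix.unitaryGroup (Fin (N + 1) × Fin d) ℂ) (z : ℂ) (hz : ‖z‖ < 1) :
    schurFn d N (E * D) j z = schurFn d N D j z * schurFn d N E j z ∧
    schurFn d N (D * E) j z = schurFn d N E j z * schurFn d N D j z := by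
  have hs : blockProj d N j + blkQ d N (· < j) + blkQ d N (j < ·) = 1 := by
    rw [blockProj_eq, blkQ, blkQ, blkQ, diagonal_add, diagonal_add, ← diagonal_one]
    congr 1
    ext p
    rcases lt_trichotomy p.1.val j with h | h | h
    · simp [h, h.ne, h.not_gt]
    · simp [h]
    · simp [h, h.ne', h.not_gt]
  have hs' : blockProj d N j + blkQ d N (j < ·) + blkQ d N (· < j) = 1 := by
    rw [← hs]; abel
  have d1 := hD.mul_blkQ (t := (j < ·)) (fun i a b => by omega)
  have e1 := hE.mul_blkQ (t := (· < j)) (fun i a b => by omega)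
  unfold schurFn
  constructor
  · refine khr_abstract D E _ _ _ z hs ?_ ?_ ?_ ?_ d1.1 d1.2 e1.1 e1.2
      (isUnit_schur d N j D uD z hz) (isUnit_schur d N j E uE z hz)
    all_goals
      first
      | rw [blockProj_eq]
      | skip
      exact blkQ_mul_disj _ _ _ _ (fun i a b => by omega)
  · refine khr_abstract E D _ _ _ z hs' ?_ ?_ ?_ ?_ e1.1 e1.2 d1.1 d1.2
      (isUnit_schur d N j E uE z hz) (isUnit_schur d N j D uD z hz)
    all_goals
      first
      | rw [blockProj_eq]
      | skip
      exact blkQ_mul_disj _ _ _ _ (fun i a b => by omega)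

/-- index embedding -/
def fEmb (d N o m : ℕ) (h : o + m ≤ N) (r : Fin (m + 1) × Fin d) : Fin (N + 1) × Fin d :=
  (⟨o + r.1.val, by omega⟩, r.2)

theorem fEmb_inj (d N o m : ℕ) (h : o + m ≤ N) : Function.Injective (fEmb d N o m h) := by
  rintro ⟨a, b⟩ ⟨c, e⟩ hh
  simp only [fEmb, Prod.mk.injEq, Fin.mk.injEq] at hh
  ext
  · simp; omega
  · simp [hh.2]

theorem embedAt_in (d N o m : ℕ) (h : o + m ≤ N) (M) (r s : Fin (m + 1) × Fin d) :
    embedAt d N o m M (fEmb d N o m h r) (fEmb d N o m h s) = M r s := by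
  have h1 := r.1.isLt
  have h2 := s.1.isLt
  have hc : o ≤ (fEmb d N o m h r).1.val ∧ (fEmb d N o m h r).1.val ≤ o + m ∧
      o ≤ (fEmb d N o m h s).1.val ∧ (fEmb d N o m h s).1.val ≤ o + m := by
    simp only [fEmb]; omega
  unfold embedAt
  rw [dif_pos hc]
  simp [fEmb]

theorem mem_range_fEmb (d N o m : ℕ) (h : o + m ≤ N) (p : Fin (N + 1) × Fin d) :
    p ∈ Set.range (fEmb d N o m h) ↔ o ≤ p.1.val ∧ p.1.val ≤ o + m := by
  constructor
  · rintro ⟨r, rfl⟩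
    have := r.1.isLt
    simp only [fEmb]
    omega
  · rintro ⟨h1, h2⟩
    refine ⟨(⟨p.1.val - o, by omega⟩, p.2), ?_⟩
    ext
    · simp [fEmb]; omega
    · simp [fEmb]

theorem embedAt_out (d N o m : ℕ) (h : o + m ≤ N) (M) (p q : Fin (N + 1) × Fin d)
    (hpq : ¬ (p ∈ Set.range (fEmb d N o m h) ∧ q ∈ Set.range (fEmb d N o m h))) :
    embedAt d N o m M p q = (1 : Matrix _ _ ℂ) p q := by
  rw [mem_range_fEmb, mem_range_fEmb] at hpq
  simp only [embedAt]
  rw [dif_neg (by omega), one_apply]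

theorem embedAt_ext (d N o m : ℕ) (h : o + m ≤ N) (M)
    (Y : Matrix (Fin (N + 1) × Fin d) (Fin (N + 1) × Fin d) ℂ)
    (h1 : ∀ r s, Y (fEmb d N o m h r) (fEmb d N o m h s) = M r s)
    (h2 : ∀ p q, ¬ (p ∈ Set.range (fEmb d N o m h) ∧ q ∈ Set.range (fEmb d N o m h)) →
      Y p q = (1 : Matrix _ _ ℂ) p q) : embedAt d N o m M = Y := by
  ext p q
  by_cases hpq : p ∈ Set.range (fEmb d N o m h) ∧ q ∈ Set.range (fEmb d N o m h)
  · obtain ⟨⟨r, rfl⟩, ⟨s, rfl⟩⟩ := hpq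
    rw [embedAt_in, h1]
  · rw [embedAt_out d N o m h M p q hpq, h2 p q hpq]

theorem embedAt_one (d N o m : ℕ) (h : o + m ≤ N) : embedAt d N o m 1 = 1 := by
  refine embedAt_ext d N o m h _ _ ?_ (fun _ _ _ => rfl)
  intro r s
  simp [one_apply, (fEmb_inj d N o m h).eq_iff]

theorem embedAt_mul (d N o m : ℕ) (h : o + m ≤ N) (A B) :
    embedAt d N o m (A * B) = embedAt d N o m A * embedAt d N o m B := by
  refine embedAt_ext d N o m h _ _ ?_ ?_
  · intro r s
    rw [mul_apply, mul_apply]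
    symm
    refine Fintype.sum_of_injective (fEmb d N o m h) (fEmb_inj d N o m h) _ _ ?_ ?_
    · intro t ht
      rw [embedAt_out d N o m h A _ t (fun hh => ht hh.2), one_apply_ne, zero_mul]
      rintro rfl
      exact ht ⟨r, rfl⟩
    · intro t
      rw [embedAt_in, embedAt_in]
  · intro p q hpq
    by_cases hp : p ∈ Set.range (fEmb d N o m h)
    · have hq : q ∉ Set.range (fEmb d N o m h) := fun hq => hpq ⟨hp, hq⟩
      rw [mul_apply]
      have : ∀ t, embedAt d N o m B t q = (1 : Matrix _ _ ℂ) t q := fun t =>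
        embedAt_out d N o m h B t q (fun hh => hq hh.2)
      simp only [this]
      rw [← mul_apply, mul_one, embedAt_out d N o m h A p q hpq]
    · rw [mul_apply]
      have : ∀ t, embedAt d N o m A p t = (1 : Matrix _ _ ℂ) p t := fun t =>
        embedAt_out d N o m h A p t (fun hh => hp hh.1)
      simp only [this]
      rw [← mul_apply, one_mul, embedAt_out d N o m h B p q hpq]

theorem embedAt_star (d N o m : ℕ) (h : o + m ≤ N) (A) :
    embedAt d N o m (star A) = star (embedAt d N o m A) := by
  refine embedAt_ext d N o m h _ _ ?_ ?_
  · intro r s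
    rw [star_apply, star_apply, embedAt_in]
  · intro p q hpq
    rw [star_apply, embedAt_out d N o m h A q p (fun hh => hpq hh.symm), ← star_apply, star_one]

theorem embedAt_theta (d N o m k : ℕ) (h : o + m ≤ N) (hk : k < m)
    (A B C : Matrix (Fin d) (Fin d) ℂ) :
    embedAt d N o m (thetaBlock d m k A B C) = thetaBlock d N (o + k) A B C := by
  refine embedAt_ext d N o m h _ _ ?_ ?_
  · intro r s
    simp only [thetaBlock, (fEmb_inj d N o m h).eq_iff]
    simp [fEmb, add_assoc]
  · intro p q hpq
    rw [mem_range_fEmb, mem_range_fEmb] at hpq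
    simp only [thetaBlock]
    rw [if_neg (by omega), if_neg (by omega), if_neg (by omega), if_neg (by omega), one_apply]

/-- The embedding as a monoid homomorphism. -/
noncomputable def embHom (d N o m : ℕ) (h : o + m ≤ N) :
    Matrix (Fin (m + 1) × Fin d) (Fin (m + 1) × Fin d) ℂ →*
    Matrix (Fin (N + 1) × Fin d) (Fin (N + 1) × Fin d) ℂ where
  toFun := embedAt d N o m
  map_one' := embedAt_one d N o m h
  map_mul' := embedAt_mul d N o m h

open scoped MatrixOrder Matrix.Norms.L2Operator in
theorem psd_factor {d : ℕ} (L : Matrix (Fin d) (Fin d) ℂ) (hL : L.PosSemidef) :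
    ∃ B : Matrix (Fin d) (Fin d) ℂ, L = Bᴴ * B :=
  (CStarAlgebra.nonneg_iff_eq_star_mul_self (a := L)).mp hL.nonneg

theorem rho_intertwine {d : ℕ} (A L R : Matrix (Fin d) (Fin d) ℂ)
    (hL : L.PosSemidef) (hL2 : L * L = 1 - Aᴴ * A)
    (hR : R.PosSemidef) (hR2 : R * R = 1 - A * Aᴴ) : R * A = A * L := by
  set Y := R * A - A * L with hY
  have h0 : R * Y + Y * L = 0 := by
    have e : R * Y + Y * L = (R * R) * A - A * (L * L) := by rw [hY]; noncomm_ring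
    rw [e, hL2, hR2]; noncomm_ring
  have p1 : (Yᴴ * R * Y).PosSemidef := hR.conjTranspose_mul_mul_same Y
  have p2 : (Y * L * Yᴴ).PosSemidef := hL.mul_mul_conjTranspose_same Y
  have t0 : (Yᴴ * R * Y).trace + (Y * L * Yᴴ).trace = 0 := by
    rw [trace_mul_comm (Y * L) Yᴴ, ← trace_add, mul_assoc, ← mul_add, h0]; simp
  have t2 : (Y * L * Yᴴ).trace = 0 := by
    have a := p1.trace_nonneg
    have b := p2.trace_nonneg
    exact ((add_eq_zero_iff_of_nonneg a b).mp t0).2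
  have q2 := p2.trace_eq_zero_iff.mp t2
  -- (L Yᴴ)ᴴ (L Yᴴ) = Y L L Yᴴ
  have q3 : L * Yᴴ = 0 := by
    obtain ⟨B, hB⟩ := psd_factor L hL
    have hB' : L = Bᴴ * B := hB
    have : (B * Yᴴ)ᴴ * (B * Yᴴ) = 0 := by
      rw [conjTranspose_mul, conjTranspose_conjTranspose, ← q2, hB']
      simp only [mul_assoc]
    have := conjTranspose_mul_self_eq_zero.mp this
    rw [hB', mul_assoc, this, mul_zero]
  have q4 : Y * L = 0 := by
    have := congrArg conjTranspose q3
    rwa [conjTranspose_mul, conjTranspose_conjTranspose, hL.1.eq, conjTranspose_zero] at this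
  have q5 : R * Y = 0 := by rw [q4, add_zero] at h0; exact h0
  have hYH : Yᴴ = Aᴴ * R - L * Aᴴ := by
    rw [hY, conjTranspose_sub, conjTranspose_mul, conjTranspose_mul, hL.1.eq, hR.1.eq]
  have q6 : (Yᴴ * Y).trace = 0 := by
    rw [hYH, sub_mul, mul_assoc, q5, mul_zero, zero_sub, trace_neg, mul_assoc, trace_mul_comm,
      mul_assoc, q4, mul_zero, trace_zero, neg_zero]
  have q7 := trace_conjTranspose_mul_self_eq_zero_iff.mp q6
  exact sub_eq_zero.mp q7

theorem theta_unitary1 {d : ℕ} (A L R : Matrix (Fin d) (Fin d) ℂ)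
    (hL : L.PosSemidef) (hL2 : L * L = 1 - Aᴴ * A)
    (hR : R.PosSemidef) (hR2 : R * R = 1 - A * Aᴴ) :
    thetaBlock d 1 0 A L R * star (thetaBlock d 1 0 A L R) = 1 := by
  have h1 := rho_intertwine A L R hL hL2 hR hR2
  have h2 : Aᴴ * R = L * Aᴴ := by
    have := congrArg conjTranspose h1
    rwa [conjTranspose_mul, conjTranspose_mul, hL.1.eq, hR.1.eq] at this
  have e1 : Aᴴ * A + L * Lᴴ = 1 := by rw [hL.1.eq, hL2]; abel
  have e2 : Aᴴ * Rᴴ + L * (-A)ᴴ = 0 := by rw [hR.1.eq, h2, conjTranspose_neg]; simp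
  have e3 : R * A + (-A) * Lᴴ = 0 := by rw [hL.1.eq, h1]; simp
  have e4 : R * Rᴴ + (-A) * (-A)ᴴ = 1 := by rw [hR.1.eq, hR2, conjTranspose_neg]; simp
  ext ⟨a, i⟩ ⟨b, k⟩
  rw [mul_apply, Fintype.sum_prod_type, Fin.sum_univ_two]
  have e1' := congrFun (congrFun e1 i) k
  have e2' := congrFun (congrFun e2 i) k
  have e3' := congrFun (congrFun e3 i) k
  have e4' := congrFun (congrFun e4 i) k
  simp only [Matrix.add_apply, mul_apply, one_apply, Matrix.zero_apply, conjTranspose_apply] at e1' e2' e3' e4'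
  fin_cases a <;> fin_cases b <;>
    simp [thetaBlock, one_apply, star_apply] at e1' e2' e3' e4' ⊢ <;> assumption

theorem theta_unitary {d : ℕ} (N k : ℕ) (hk : k < N) (A L R : Matrix (Fin d) (Fin d) ℂ)
    (hL : L.PosSemidef) (hL2 : L * L = 1 - Aᴴ * A)
    (hR : R.PosSemidef) (hR2 : R * R = 1 - A * Aᴴ) :
    thetaBlock d N k A L R ∈ Matrix.unitaryGroup (Fin (N + 1) × Fin d) ℂ := by
  rw [mem_unitaryGroup_iff]
  have h := embedAt_theta d N k 1 0 (by omega) (by omega) A L R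
  rw [add_zero] at h
  rw [← h, ← embedAt_star _ _ _ _ (by omega), ← embedAt_mul _ _ _ _ (by omega),
    theta_unitary1 A L R hL hL2 hR hR2, embedAt_one _ _ _ _ (by omega)]

/-- Product of blocks with offset. -/
noncomputable def gProd (d N : ℕ) (α ρl ρr : ℕ → Matrix (Fin d) (Fin d) ℂ) (o n : ℕ)
    (par : ℕ → Prop) [DecidablePred par] :
    Matrix (Fin (N + 1) × Fin d) (Fin (N + 1) × Fin d) ℂ :=
  ((List.range n).map fun k =>
    if par k then thetaBlock d N (o + k) (α (o + k)) (ρl (o + k)) (ρr (o + k)) else 1).prod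

theorem gProd_split (d N : ℕ) (α ρl ρr : ℕ → Matrix (Fin d) (Fin d) ℂ) (j : ℕ) (hj : j ≤ N)
    (par par' : ℕ → Prop) [DecidablePred par] [DecidablePred par']
    (h : ∀ k, par (j + k) ↔ par' k) :
    gProd d N α ρl ρr 0 N par
      = gProd d N α ρl ρr 0 j par * gProd d N α ρl ρr j (N - j) par' := by
  unfold gProd
  have e : List.range N = List.range j ++ (List.range (N - j)).map (j + ·) := by
    rw [← List.range_add]; congr 1; omega
  rw [e, List.map_append, List.prod_append, List.map_map]
  congr 2
  apply List.map_congr_left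
  intro k _
  simp [h]

theorem gProd_induct (d N : ℕ) (α ρl ρr : ℕ → Matrix (Fin d) (Fin d) ℂ) (o n : ℕ)
    (par : ℕ → Prop) [DecidablePred par]
    (S : Matrix (Fin (N + 1) × Fin d) (Fin (N + 1) × Fin d) ℂ → Prop)
    (h1 : S 1) (hm : ∀ X Y, S X → S Y → S (X * Y))
    (h : ∀ k < n, par k →
      S (thetaBlock d N (o + k) (α (o + k)) (ρl (o + k)) (ρr (o + k)))) :
    S (gProd d N α ρl ρr o n par) := by
  unfold gProd
  apply List.prod_induction S (fun X Y => hm X Y) h1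
  intro x hx
  rw [List.mem_map] at hx
  obtain ⟨k, hk, rfl⟩ := hx
  rw [List.mem_range] at hk
  split_ifs with hp
  · exact h k hk hp
  · exact h1

theorem gProd_idOff (d N : ℕ) (α ρl ρr : ℕ → Matrix (Fin d) (Fin d) ℂ) (o n : ℕ)
    (par : ℕ → Prop) [DecidablePred par] (s : ℕ → Prop)
    (h : ∀ k < n, par k → s (o + k) ∧ s (o + k + 1)) :
    IdOff d N s (gProd d N α ρl ρr o n par) := by
  apply gProd_induct
  · exact IdOff.one d N s
  · exact fun X Y hX hY => hX.mul hY
  · intro k hk hp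
    exact thetaBlock_idOff _ _ _ _ _ _ _ (h k hk hp).1 (h k hk hp).2

theorem embed_gProd (d N : ℕ) (α ρl ρr : ℕ → Matrix (Fin d) (Fin d) ℂ) (o m : ℕ)
    (hm : o + m ≤ N) (par : ℕ → Prop) [DecidablePred par] :
    embedAt d N o m (gProd d m (fun k => α (o + k)) (fun k => ρl (o + k))
      (fun k => ρr (o + k)) 0 m par) = gProd d N α ρl ρr o m par := by
  unfold gProd
  change embHom d N o m hm _ = _
  rw [map_list_prod, List.map_map]
  congr 1
  apply List.map_congr_left
  intro k hk
  rw [List.mem_range] at hk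
  simp only [Function.comp, embHom, MonoidHom.coe_mk, OneHom.coe_mk, zero_add]
  split_ifs
  · rw [embedAt_theta _ _ _ _ _ hm hk]
  · exact embedAt_one _ _ _ _ hm

theorem cmvL_eq (d N : ℕ) (α ρl ρr : ℕ → Matrix (Fin d) (Fin d) ℂ) :
    cmvLfactor d N α ρl ρr = gProd d N α ρl ρr 0 N Even := by
  simp [cmvLfactor, gProd]

theorem cmvM_eq (d N : ℕ) (α ρl ρr : ℕ → Matrix (Fin d) (Fin d) ℂ) :
    cmvMfactor d N α ρl ρr = gProd d N α ρl ρr 0 N Odd := by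
  simp [cmvMfactor, gProd]

end Helpers

/-- (Khrushchev's formula for finite block CMV matrices.)
For `d ≥ 1`, `N ≥ 1`, `d×d` contractions `α_0, …, α_{N−1}` (with `ρ^L_j, ρ^R_j` the
positive semidefinite square roots of `1 − α_jᴴα_j`, `1 − α_jα_jᴴ`), the finite block CMV
matrices `C_N`, `Ĉ_N` are unitary; for every unitary `X` of size `(N+1)d` and `|z| < 1`
the matrix `X − z(1 − P_j)` is invertible (defining the Schur function `S_j(X,z)`); and
with `D_j = C_j ⊕ 1`, `D̂_j = Ĉ_j ⊕ 1`, `E_j = 1 ⊕ C_{N−j}(α_j, …)`,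
`Ê_j = 1 ⊕ Ĉ_{N−j}(α_j, …)`, for all `0 < j < N` and `|z| < 1`:
even `j`: `S_j(C_N,z) = S_j(D_j,z)·S_j(E_j,z)` and `S_j(Ĉ_N,z) = S_j(Ê_j,z)·S_j(D̂_j,z)`;
odd `j`: `S_j(C_N,z) = S_j(Ê_j,z)·S_j(D_j,z)` and `S_j(Ĉ_N,z) = S_j(D̂_j,z)·S_j(E_j,z)`. -/
theorem statement17 (d N : ℕ) (hd : 1 ≤ d) (hN : 1 ≤ N)
    (α ρl ρr : ℕ → Matrix (Fin d) (Fin d) ℂ)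
    (hρl : ∀ j, (ρl j).PosSemidef ∧
      ρl j * ρl j = (1 : Matrix (Fin d) (Fin d) ℂ) - (α j)ᴴ * α j)
    (hρr : ∀ j, (ρr j).PosSemidef ∧
      ρr j * ρr j = (1 : Matrix (Fin d) (Fin d) ℂ) - α j * (α j)ᴴ)
    (j : ℕ) (hj0 : 0 < j) (hjN : j < N) (z : ℂ) (hz : ‖z‖ < 1) :
    cmvC d N α ρl ρr ∈ Matrix.unitaryGroup (Fin (N + 1) × Fin d) ℂ ∧
    cmvChat d N α ρl ρr ∈ Matrix.unitaryGroup (Fin (N + 1) × Fin d) ℂ ∧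
    (∀ X ∈ Matrix.unitaryGroup (Fin (N + 1) × Fin d) ℂ, ∀ w : ℂ, ‖w‖ < 1 →
      ∀ j' ≤ N, IsUnit (X - w • (1 - blockProj d N j'))) ∧
    (Even j →
      schurFn d N (cmvC d N α ρl ρr) j z =
        schurFn d N (embedAt d N 0 j (cmvC d j α ρl ρr)) j z *
          schurFn d N
            (embedAt d N j (N - j)
              (cmvC d (N - j) (fun k => α (j + k)) (fun k => ρl (j + k))
                (fun k => ρr (j + k)))) j z ∧
      schurFn d N (cmvChat d N α ρl ρr) j z =
        schurFn d N
            (embedAt d N j (N - j)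
              (cmvChat d (N - j) (fun k => α (j + k)) (fun k => ρl (j + k))
                (fun k => ρr (j + k)))) j z *
          schurFn d N (embedAt d N 0 j (cmvChat d j α ρl ρr)) j z) ∧
    (Odd j →
      schurFn d N (cmvC d N α ρl ρr) j z =
        schurFn d N
            (embedAt d N j (N - j)
              (cmvChat d (N - j) (fun k => α (j + k)) (fun k => ρl (j + k))
                (fun k => ρr (j + k)))) j z *
          schurFn d N (embedAt d N 0 j (cmvC d j α ρl ρr)) j z ∧
      schurFn d N (cmvChat d N α ρl ρr) j z =
        schurFn d N (embedAt d N 0 j (cmvChat d j α ρl ρr)) j z *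
          schurFn d N
            (embedAt d N j (N - j)
              (cmvC d (N - j) (fun k => α (j + k)) (fun k => ρl (j + k))
                (fun k => ρr (j + k)))) j z) := by
  have uG : ∀ (o n : ℕ) (par : ℕ → Prop) [DecidablePred par], o + n ≤ N →
      gProd d N α ρl ρr o n par ∈ Matrix.unitaryGroup (Fin (N + 1) × Fin d) ℂ := by
    intro o n par _ hn
    apply gProd_induct
    · exact one_mem _
    · exact fun X Y hX hY => mul_mem hX hY
    · intro k hk _
      exact theta_unitary N (o + k) (by omega) _ _ _ (hρl _).1 (hρl _).2 (hρr _).1 (hρr _).2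
  have sh : ∀ m, gProd d m α ρl ρr = gProd d m (fun k => α (0 + k)) (fun k => ρl (0 + k))
      (fun k => ρr (0 + k)) := by intro m; simp
  have eD : ∀ (par : ℕ → Prop) [DecidablePred par],
      embedAt d N 0 j (gProd d j α ρl ρr 0 j par) = gProd d N α ρl ρr 0 j par := by
    intro par _
    rw [sh]
    exact embed_gProd d N α ρl ρr 0 j (by omega) par
  have eE : ∀ (par : ℕ → Prop) [DecidablePred par],
      embedAt d N j (N - j) (gProd d (N - j) (fun k => α (j + k)) (fun k => ρl (j + k))
        (fun k => ρr (j + k)) 0 (N - j) par) = gProd d N α ρl ρr j (N - j) par := fun par _ =>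
    embed_gProd d N α ρl ρr j (N - j) (by omega) par
  have sD : ∀ (par : ℕ → Prop) [DecidablePred par],
      IdOff d N (· ≤ j) (gProd d N α ρl ρr 0 j par) := fun par _ =>
    gProd_idOff _ _ _ _ _ _ _ _ _ (fun k hk _ => by constructor <;> omega)
  have sE : ∀ (par : ℕ → Prop) [DecidablePred par],
      IdOff d N (j ≤ ·) (gProd d N α ρl ρr j (N - j) par) := fun par _ =>
    gProd_idOff _ _ _ _ _ _ _ _ _ (fun k hk _ => by constructor <;> omega)
  have m0 : 0 + j ≤ N := by omega
  have m1 : j + (N - j) ≤ N := by omega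
  have hsch := fun (p q p' q' : ℕ → Prop) [DecidablePred p] [DecidablePred q]
      [DecidablePred p'] [DecidablePred q'] =>
    schur_lem d N j _ _ ((sD p).mul (sD q)) ((sE p').mul (sE q'))
      (mul_mem (uG 0 j p m0) (uG 0 j q m0)) (mul_mem (uG j (N - j) p' m1) (uG j (N - j) q' m1)) z hz
  have lt : ∀ (par : ℕ → Prop) [DecidablePred par], ¬ par (j - 1) →
      IdOff d N (· < j) (gProd d N α ρl ρr 0 j par) := fun par _ hp =>
    gProd_idOff _ _ _ _ _ _ _ _ _ (fun k hk hpk => by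
      have : k ≠ j - 1 := fun h => hp (h ▸ hpk)
      constructor <;> omega)
  have gt : ∀ (par : ℕ → Prop) [DecidablePred par], ¬ par 0 →
      IdOff d N (j < ·) (gProd d N α ρl ρr j (N - j) par) := fun par _ hp =>
    gProd_idOff _ _ _ _ _ _ _ _ _ (fun k hk hpk => by
      have : k ≠ 0 := fun h => hp (h ▸ hpk)
      constructor <;> omega)
  refine ⟨?_, ?_, ?_, ?_, ?_⟩
  · rw [cmvC, cmvL_eq, cmvM_eq]
    exact mul_mem (uG _ _ _ (by omega)) (uG _ _ _ (by omega))
  · rw [cmvChat, cmvL_eq, cmvM_eq]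
    exact mul_mem (uG _ _ _ (by omega)) (uG _ _ _ (by omega))
  · intro X hX w hw j' _
    exact isUnit_schur d N j' X hX w hw
  · intro hev
    have n1 : ¬ Even (j - 1) := by
      rw [Nat.not_even_iff_odd]; exact Nat.Even.sub_odd hj0 hev odd_one
    have cA := (lt Even n1).commute (sE Even) (fun i a b => by omega)
    have cB := (gt Odd (by decide)).commute (sD Odd) (fun i a b => by omega)
    have cAB := (gt Odd (by decide)).commute (sD Even) (fun i a b => by omega)
    have s1 := gProd_split d N α ρl ρr j hjN.le Even Even
      (fun k => by simp [Nat.even_add, hev])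
    have s2 := gProd_split d N α ρl ρr j hjN.le Odd Odd
      (fun k => by simp [Nat.odd_add', hev])
    simp only [cmvC, cmvChat, cmvL_eq, cmvM_eq, embedAt_mul d N 0 j m0,
      embedAt_mul d N j (N - j) m1, eD, eE]
    rw [s1, s2]
    have h1 := (hsch Even Odd Even Odd).1
    have h2 := (hsch Odd Even Odd Even).2
    rw [← h1, ← h2]
    generalize gProd d N α ρl ρr 0 j Even = A at *
    generalize gProd d N α ρl ρr 0 j Odd = B at *
    generalize gProd d N α ρl ρr j (N - j) Even = A' at *
    generalize gProd d N α ρl ρr j (N - j) Odd = B' at *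
    constructor
    · congr 1
      rw [cA, ← cB, mul_assoc, ← mul_assoc A, ← cAB]; simp only [mul_assoc]
    · congr 1
      rw [mul_assoc, ← mul_assoc B', cAB]; simp only [mul_assoc]
  · intro hod
    have hne : ¬ Even j := Nat.not_even_iff_odd.mpr hod
    have n1 : ¬ Odd (j - 1) := by
      rw [Nat.not_odd_iff_even]; exact Nat.Odd.sub_odd hod odd_one
    have cA := (lt Odd n1).commute (sE Even) (fun i a b => by omega)
    have cB := (gt Odd (by decide)).commute (sD Even) (fun i a b => by omega)
    have cAB := (gt Odd (by decide)).commute (sD Odd) (fun i a b => by omega)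
    have s1 := gProd_split d N α ρl ρr j hjN.le Even Odd
      (fun k => by simp [Nat.even_add, hne])
    have s2 := gProd_split d N α ρl ρr j hjN.le Odd Even
      (fun k => by simp [Nat.odd_add, hod])
    simp only [cmvC, cmvChat, cmvL_eq, cmvM_eq, embedAt_mul d N 0 j m0,
      embedAt_mul d N j (N - j) m1, eD, eE]
    rw [s1, s2]
    have h1 := (hsch Even Odd Odd Even).2
    have h2 := (hsch Odd Even Even Odd).1
    rw [← h1, ← h2]
    generalize gProd d N α ρl ρr 0 j Even = A at *
    generalize gProd d N α ρl ρr 0 j Odd = B at *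
    generalize gProd d N α ρl ρr j (N - j) Even = A' at *
    generalize gProd d N α ρl ρr j (N - j) Odd = B' at *
    constructor
    · congr 1
      rw [mul_assoc, ← mul_assoc B', cAB]; simp only [mul_assoc]
    · congr 1
      rw [cA, ← cB, mul_assoc, ← mul_assoc B, ← cAB]; simp only [mul_assoc]
end
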